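/- arXiv:math-ph/0510091 — 3 statements merged into one kernel-verified Lean document; each statement's English description precedes it below -/
import Mathlib

section
/- Assume Hypothesis A. For every closed curve γ : [0,1] → ℝ³ (γ(0) = γ(1)) that is absolutely continuous with derivative γ' ∈ L²((0,1); ℝ³), the energy admits the Fourier representation H(γ) = (1/(2(2π)³)) ∫_{ℝ³} φ̂(k) ‖∫₀¹ e^{i⟨k, γ(ξ)⟩} γ'(ξ) dξ‖² dk, where the inner integral is a vector in ℂ³ and ‖·‖ denotes its Hermitian norm. -/
noncomputable section
open MeasureTheory Real Set

/-- Three-dimensional Euclidean space. -/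
abbrev E3 := EuclideanSpace ℝ (Fin 3)

/-- The Fourier transform `∫_{ℝ³} e^{i⟨k,x⟩} f(x) dx` of `f : ℝ³ → ℝ`, as a complex number. -/
def fourierInt (f : E3 → ℝ) (k : E3) : ℂ :=
  ∫ x : E3, Complex.exp (Complex.I * ((inner ℝ k x : ℝ) : ℂ)) * (f x : ℂ)

/-- Hypothesis A: `φ` is even, continuous, integrable, its Fourier transform is the real
nonnegative function `φhat`, and `φhat` satisfies the moment condition (A.4). -/
structure HypA (φ : E3 → ℝ) (φhat : E3 → ℝ) : Prop where
  even : ∀ x, φ (-x) = φ x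
  cont : Continuous φ
  integrable : Integrable φ
  fourier_eq : ∀ k, (φhat k : ℂ) = fourierInt φ k
  nonneg : ∀ k, 0 ≤ φhat k
  moment : Integrable (fun k : E3 => (1 + ‖k‖ ^ 2) ^ 2 * φhat k)

/-- `γ : [0,1] → ℝ³` is a closed curve, absolutely continuous with derivative `γd`
belonging to `L²((0,1); ℝ³)`. -/
structure IsH1Loop (γ γd : ℝ → E3) : Prop where
  closed : γ 0 = γ 1
  deriv_eq : ∀ ξ ∈ Icc (0:ℝ) 1, γ ξ = γ 0 + ∫ s in (0:ℝ)..ξ, γd s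
  memL2 : MemLp γd 2 (volume.restrict (Ioc (0:ℝ) 1))

/-- The kinetic energy `H(γ) = (1/2)∫₀¹∫₀¹ φ(γ(ξ)-γ(η)) ⟨γ'(ξ), γ'(η)⟩ dξ dη`. -/
def energy (φ : E3 → ℝ) (γ γd : ℝ → E3) : ℝ :=
  (1 / 2) * ∫ ξ in (0:ℝ)..1, ∫ η in (0:ℝ)..1, φ (γ ξ - γ η) * (inner ℝ (γd ξ) (γd η) : ℝ)

/-- The cross product on `ℝ³`. -/
def cross3 (a b : E3) : E3 := WithLp.toLp 2 (crossProduct a.ofLp b.ofLp)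

/-- The induced velocity `u(x) = ∫₀¹ ∇φ(x - γ(ξ)) ∧ γ'(ξ) dξ`. -/
def velocity (φ : E3 → ℝ) (γ γd : ℝ → E3) (x : E3) : E3 :=
  ∫ ξ in (0:ℝ)..1, cross3 (gradient φ (x - γ ξ)) (γd ξ)

/-- `ℂ³` with the Hermitian norm. -/
abbrev C3 := EuclideanSpace ℂ (Fin 3)

/-- The vector `∫₀¹ e^{i⟨k, γ(ξ)⟩} γ'(ξ) dξ ∈ ℂ³`. -/
def loopFourier (γ γd : ℝ → E3) (k : E3) : C3 :=
  ∫ ξ in (0:ℝ)..1,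
    (WithLp.toLp 2 fun i => Complex.exp (Complex.I * ((inner ℝ k (γ ξ) : ℝ) : ℂ)) * ((γd ξ i : ℝ) : ℂ) : C3)

/-- Under Hypothesis A the Fourier transform of `φ` is integrable. -/
lemma HypA.integrable_fourier {φ φhat : E3 → ℝ} (hA : HypA φ φhat) : Integrable φhat := by
  have hc : Continuous (fun k : E3 => ((1 + ‖k‖ ^ 2) ^ 2)⁻¹) :=
    Continuous.inv₀ (by fun_prop) (fun k => by positivity)
  refine (hA.moment.bdd_mul (c := 1) hc.aestronglyMeasurable (.of_forall fun k => ?_)).congr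
    (.of_forall fun k => ?_)
  · rw [Real.norm_of_nonneg (by positivity)]
    exact inv_le_one_of_one_le₀ (one_le_pow₀ (by nlinarith [sq_nonneg ‖k‖]))
  · have : (1 + ‖k‖ ^ 2) ^ 2 ≠ 0 := by positivity
    field_simp

/-- Fourier inversion for `φ` satisfying Hypothesis A. -/
lemma HypA.fourier_inversion {φ φhat : E3 → ℝ} (hA : HypA φ φhat) (x : E3) :
    (φ x : ℂ) = (1 / (2 * π) ^ 3 : ℝ) *
      ∫ k : E3, Complex.exp (Complex.I * ((inner ℝ k x : ℝ) : ℂ)) * (φhat k : ℂ) := by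
  have hF : FourierTransform.fourier (fun y : E3 => (φ y : ℂ))
      = fun w => (φhat ((-(2 * π)) • w) : ℂ) := by
    ext w
    rw [Real.fourier_eq', hA.fourier_eq, fourierInt]
    congr 1 with v
    rw [inner_smul_left, real_inner_comm, smul_eq_mul]
    congr 2
    push_cast
    simp
    ring
  have hcont : Continuous (fun y : E3 => (φ y : ℂ)) := Complex.continuous_ofReal.comp hA.cont
  have h2π : -(2 * π) ≠ 0 := by simp [Real.pi_ne_zero]
  have hFint : Integrable (FourierTransform.fourier (fun y : E3 => (φ y : ℂ))) := by
    rw [hF]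
    exact (hA.integrable_fourier.comp_smul h2π).ofReal
  have hinv := congrFun (hcont.fourierInv_fourier_eq hA.integrable.ofReal hFint) (-x)
  simp only [hA.even] at hinv
  rw [← hinv, hF, Real.fourierInv_eq']
  have hscale := Measure.integral_comp_smul volume
    (fun k : E3 => Complex.exp (Complex.I * ((inner ℝ k x : ℝ) : ℂ)) * (φhat k : ℂ)) (-(2 * π))
  rw [finrank_euclideanSpace_fin, Complex.real_smul] at hscale
  have habs : |((-(2 * π)) ^ 3)⁻¹| = 1 / (2 * π) ^ 3 := by
    rw [abs_inv, abs_pow, abs_neg, abs_of_pos (by positivity), one_div]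
  rw [← habs, ← hscale]
  congr 1 with w
  rw [inner_smul_left, inner_neg_right, smul_eq_mul]
  congr 2
  push_cast
  simp
  ring

section

variable {α : Type*} [MeasurableSpace α] {μ : Measure α} {γ γd : α → E3}

/-- The squared Hermitian norm of `∫ e^{i⟨k,γ⟩} γd` as a double integral. -/
lemma norm_sq_integral_exp_mul [SFinite μ] (hγ : AEStronglyMeasurable γ μ)
    (hγd : Integrable γd μ) (k : E3) :
    ((‖∫ ξ, (WithLp.toLp 2 fun i => Complex.exp (Complex.I * ((inner ℝ k (γ ξ) : ℝ) : ℂ)) *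
        ((γd ξ i : ℝ) : ℂ) : C3) ∂μ‖ ^ 2 : ℝ) : ℂ) =
      ∫ p, Complex.exp (Complex.I * ((inner ℝ k (γ p.1 - γ p.2) : ℝ) : ℂ)) *
        ((inner ℝ (γd p.1) (γd p.2) : ℝ) : ℂ) ∂(μ.prod μ) := by
  have hexp : AEStronglyMeasurable
      (fun ξ => Complex.exp (Complex.I * ((inner ℝ k (γ ξ) : ℝ) : ℂ))) μ :=
    (by fun_prop : Continuous fun y : E3 => Complex.exp (Complex.I * ((inner ℝ k y : ℝ) : ℂ)))
      |>.comp_aestronglyMeasurable hγ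
  have hcoord (i : Fin 3) : Integrable (fun ξ => γd ξ i) μ :=
    (EuclideanSpace.proj (𝕜 := ℝ) i).integrable_comp hγd
  have hint (i : Fin 3) : Integrable (fun ξ =>
      Complex.exp (Complex.I * ((inner ℝ k (γ ξ) : ℝ) : ℂ)) * ((γd ξ i : ℝ) : ℂ)) μ :=
    (hcoord i).ofReal.bdd_mul (c := 1) hexp (.of_forall fun ξ => by
      rw [mul_comm, Complex.norm_exp_ofReal_mul_I])
  have hvec : Integrable (fun ξ => (WithLp.toLp 2 fun i =>
      Complex.exp (Complex.I * ((inner ℝ k (γ ξ) : ℝ) : ℂ)) * ((γd ξ i : ℝ) : ℂ) : C3)) μ :=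
    (PiLp.continuousLinearEquiv 2 ℂ (fun _ : Fin 3 => ℂ)).symm.toContinuousLinearMap.integrable_comp
      (Integrable.of_eval hint)
  have hproj (i : Fin 3) := (EuclideanSpace.proj (𝕜 := ℂ) i).integral_comp_comm hvec
  simp only [PiLp.proj_apply] at hproj
  rw [EuclideanSpace.norm_sq_eq]
  push_cast
  simp_rw [← hproj, ← Complex.mul_conj', ← integral_conj, ← integral_prod_mul]
  rw [← integral_finsetSum]
  · congr 1 with p
    simp only [map_mul, Complex.conj_ofReal, ← Complex.exp_conj, Complex.conj_I,
      PiLp.inner_apply (γd p.1), inner_sub_right, RCLike.inner_apply, conj_trivial]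
    push_cast
    rw [Finset.mul_sum, mul_sub, sub_eq_add_neg, Complex.exp_add, neg_mul]
    exact Finset.sum_congr rfl fun i _ => by ring
  · intro i _
    exact (hint i).mul_prod ((Complex.conjCLE.toContinuousLinearMap).integrable_comp (hint i))

/-- Joint integrability of the oscillatory kernel in frequency and the two parameters. -/
lemma integrable_fourier_kernel [SFinite μ] {f : E3 → ℝ} (hf : Integrable f)
    (hγ : AEStronglyMeasurable γ μ) (hγd : Integrable γd μ) :
    Integrable (fun q : E3 × (α × α) => (f q.1 : ℂ) *
      (Complex.exp (Complex.I * ((inner ℝ q.1 (γ q.2.1 - γ q.2.2) : ℝ) : ℂ)) *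
        ((inner ℝ (γd q.2.1) (γd q.2.2) : ℝ) : ℂ))) (volume.prod (μ.prod μ)) := by
  have hin : Integrable (fun p : α × α => (inner ℝ (γd p.1) (γd p.2) : ℝ)) (μ.prod μ) :=
    (hγd.norm.mul_prod hγd.norm).mono (hγd.1.comp_fst.inner hγd.1.comp_snd)
      (.of_forall fun p => by
        simpa using abs_real_inner_le_norm (γd p.1) (γd p.2))
  have hdiff : AEStronglyMeasurable (fun q : E3 × (α × α) => γ q.2.1 - γ q.2.2)
      (volume.prod (μ.prod μ)) := (hγ.comp_fst.sub hγ.comp_snd).comp_snd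
  have hinner : AEStronglyMeasurable
      (fun q : E3 × (α × α) => (inner ℝ q.1 (γ q.2.1 - γ q.2.2) : ℝ))
      (volume.prod (μ.prod μ)) := measurable_fst.aestronglyMeasurable.inner hdiff
  have hexp : AEStronglyMeasurable (fun q : E3 × (α × α) =>
      Complex.exp (Complex.I * ((inner ℝ q.1 (γ q.2.1 - γ q.2.2) : ℝ) : ℂ)))
      (volume.prod (μ.prod μ)) :=
    (by fun_prop : Continuous fun t : ℝ => Complex.exp (Complex.I * (t : ℂ)))
      |>.comp_aestronglyMeasurable hinner
  refine ((hf.ofReal (𝕜 := ℂ)).mul_prod (hin.ofReal (𝕜 := ℂ))).bdd_mul (c := 1) hexp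
    (.of_forall fun q => ?_) |>.congr (.of_forall fun q => ?_)
  · rw [mul_comm, Complex.norm_exp_ofReal_mul_I]
  · simp only [RCLike.ofReal_eq_complex_ofReal]
    ring

end

lemma IsH1Loop.integrable {γ γd : ℝ → E3} (hγ : IsH1Loop γ γd) :
    Integrable γd (volume.restrict (Ioc (0:ℝ) 1)) :=
  hγ.memL2.integrable (by norm_num)

lemma IsH1Loop.continuousOn {γ γd : ℝ → E3} (hγ : IsH1Loop γ γd) :
    ContinuousOn γ (Icc (0:ℝ) 1) := by
  have hint : IntegrableOn γd (uIcc (0:ℝ) 1) := by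
    rw [uIcc_of_le zero_le_one, integrableOn_Icc_iff_integrableOn_Ioc]
    exact hγ.integrable
  rw [← uIcc_of_le zero_le_one]
  refine (continuousOn_const.add
    (intervalIntegral.continuousOn_primitive_interval hint)).congr fun ξ hξ => hγ.deriv_eq ξ ?_
  rwa [← uIcc_of_le zero_le_one]

/-- Fourier representation of the energy:
`H(γ) = (1/(2(2π)³)) ∫_{ℝ³} φ̂(k) ‖∫₀¹ e^{i⟨k,γ(ξ)⟩} γ'(ξ) dξ‖² dk`. -/
theorem energy_fourier_representation (φ φhat : E3 → ℝ) (hA : HypA φ φhat)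
    (γ γd : ℝ → E3) (hγ : IsH1Loop γ γd) :
    energy φ γ γd =
      (1 / (2 * (2 * π) ^ 3)) * ∫ k : E3, φhat k * ‖loopFourier γ γd k‖ ^ 2 := by
  have hγm : AEStronglyMeasurable γ (volume.restrict (Ioc (0:ℝ) 1)) :=
    (hγ.continuousOn.mono Ioc_subset_Icc_self).aestronglyMeasurable measurableSet_Ioc
  have hK := integrable_fourier_kernel hA.integrable_fourier hγm hγ.integrable
  have hpt (p : ℝ × ℝ) : ∫ k : E3, (φhat k : ℂ) *
      (Complex.exp (Complex.I * ((inner ℝ k (γ p.1 - γ p.2) : ℝ) : ℂ)) *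
        ((inner ℝ (γd p.1) (γd p.2) : ℝ) : ℂ)) =
      (((2 * π) ^ 3 * (φ (γ p.1 - γ p.2) * inner ℝ (γd p.1) (γd p.2)) : ℝ) : ℂ) := by
    have hπ : ((2 * π : ℝ) : ℂ) ≠ 0 := by exact_mod_cast (by positivity : 2 * π ≠ 0)
    simp_rw [← mul_assoc]
    rw [integral_mul_const]
    push_cast
    rw [hA.fourier_inversion]
    push_cast at hπ ⊢
    simp_rw [mul_comm (φhat _ : ℂ)]
    field_simp
  have hprod : Integrable (fun p : ℝ × ℝ =>
      φ (γ p.1 - γ p.2) * (inner ℝ (γd p.1) (γd p.2) : ℝ))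
      ((volume.restrict (Ioc (0:ℝ) 1)).prod (volume.restrict (Ioc (0:ℝ) 1))) := by
    have h := hK.integral_prod_right.re
    simp only [hpt, RCLike.re_eq_complex_re, Complex.ofReal_re] at h
    exact (integrable_const_mul_iff (IsUnit.mk0 _ (by positivity)) _).1 h
  have hR : ∫ k : E3, φhat k * ‖loopFourier γ γd k‖ ^ 2 =
      (2 * π) ^ 3 * ∫ ξ in (0:ℝ)..1, ∫ η in (0:ℝ)..1,
        φ (γ ξ - γ η) * (inner ℝ (γd ξ) (γd η) : ℝ) := by
    simp only [intervalIntegral.integral_of_le zero_le_one]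
    rw [← integral_prod _ hprod, ← integral_const_mul]
    apply Complex.ofReal_injective
    rw [← integral_complex_ofReal, ← integral_complex_ofReal]
    simp_rw [← hpt]
    rw [← integral_integral_swap hK]
    congr 1 with k
    rw [integral_const_mul, ← norm_sq_integral_exp_mul hγm hγ.integrable, loopFourier,
      intervalIntegral.integral_of_le zero_le_one, Complex.ofReal_mul]
  rw [hR, energy]
  field_simp
end
end

section
/- Assume Hypothesis A. For every closed curve γ : [0,1] → ℝ³ (γ(0) = γ(1)) that is absolutely continuous with derivative γ' ∈ L²((0,1); ℝ³), the energy is well defined, nonnegative, and finite; more precisely 0 ≤ H(γ) ≤ (1/(2(2π)³)) (∫_{ℝ³} φ̂(k) dk) (∫₀¹ |γ'(ξ)| dξ)². -/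
noncomputable section
open MeasureTheory Real Set

namespace HypA

variable {φ φhat : E3 → ℝ}

/-- The moment condition makes the Fourier transform itself integrable. -/
theorem integrable_hat (hA : HypA φ φhat) : Integrable φhat := by
  have hpos : ∀ k : E3, 0 < (1 + ‖k‖ ^ 2) ^ 2 := fun k => by positivity
  have hcont : Continuous fun k : E3 => ((1 + ‖k‖ ^ 2) ^ 2)⁻¹ :=
    Continuous.inv₀ (by fun_prop) fun k => (hpos k).ne'
  refine (hA.moment.bdd_mul (c := 1) hcont.aestronglyMeasurable (.of_forall fun k => ?_)).congr
    (.of_forall fun k => ?_)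
  · rw [norm_inv, norm_of_nonneg (hpos k).le]
    exact inv_le_one_of_one_le₀ (one_le_pow₀ (by nlinarith [sq_nonneg ‖k‖]))
  · exact inv_mul_cancel_left₀ (hpos k).ne' _

open scoped FourierTransform in
/-- Fourier inversion in real form. -/
theorem eq_integral_cos (hA : HypA φ φhat) (x : E3) :
    φ x = ((2 * π) ^ 3)⁻¹ * ∫ k : E3, φhat k * cos (inner ℝ k x) := by
  have hF : 𝓕 (fun y : E3 => (φ y : ℂ)) = fun w => (φhat ((-(2 * π)) • w) : ℂ) := by
    funext w
    rw [Real.fourier_eq', hA.fourier_eq, fourierInt]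
    refine integral_congr_ae (.of_forall fun y => ?_)
    simp only [smul_eq_mul, inner_smul_left, real_inner_comm y w]
    congr 2
    simp
    ring
  have h2π : -(2 * π) ≠ 0 := by simp [Real.pi_ne_zero]
  have hFint : Integrable (𝓕 (fun y : E3 => (φ y : ℂ))) := by
    rw [hF]
    exact (integrable_comp_smul_iff volume (fun k : E3 => (φhat k : ℂ)) h2π).2
      hA.integrable_hat.ofReal
  have hinv := congrFun (Continuous.fourierInv_fourier_eq
    (Complex.continuous_ofReal.comp hA.cont) hA.integrable.ofReal hFint) x
  rw [show (Complex.ofReal ∘ φ) = fun y : E3 => (φ y : ℂ) from rfl, hF,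
    Real.fourierInv_eq'] at hinv
  have hsub := Measure.integral_comp_smul (volume : Measure E3)
    (fun k : E3 => Complex.exp (((-(inner ℝ k x : ℝ) : ℝ) : ℂ) * Complex.I) * (φhat k : ℂ))
    (-(2 * π))
  have hexp : Integrable fun k : E3 =>
      Complex.exp (((-(inner ℝ k x : ℝ) : ℝ) : ℂ) * Complex.I) * (φhat k : ℂ) := by
    refine hA.integrable_hat.ofReal.bdd_mul (c := 1)
      (Continuous.aestronglyMeasurable (by fun_prop)) (.of_forall fun k => ?_)
    rw [Complex.norm_exp_ofReal_mul_I]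
  have hscale : |((-(2 * π)) ^ Module.finrank ℝ E3)⁻¹| = ((2 * π) ^ 3)⁻¹ := by
    rw [finrank_euclideanSpace_fin, abs_inv, abs_pow, abs_neg, abs_of_pos Real.two_pi_pos]
  have hval : (φ x : ℂ) = ((2 * π) ^ 3)⁻¹ • ∫ k : E3,
      Complex.exp (((-(inner ℝ k x : ℝ) : ℝ) : ℂ) * Complex.I) * (φhat k : ℂ) := by
    rw [← hscale, ← hsub]
    refine hinv.symm.trans ?_
    refine integral_congr_ae (.of_forall fun k => ?_)
    simp only [smul_eq_mul, inner_smul_left]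
    simp
  have hre := congrArg Complex.re hval
  rw [Complex.ofReal_re, Complex.smul_re, smul_eq_mul] at hre
  rw [hre, show Complex.re _ = _ from (integral_re hexp).symm]
  congr 1
  refine integral_congr_ae (.of_forall fun k => ?_)
  simp only [RCLike.re_to_complex, Complex.re_mul_ofReal, Complex.exp_ofReal_mul_I_re, cos_neg]
  ring

theorem abs_le (hA : HypA φ φhat) (x : E3) :
    |φ x| ≤ ((2 * π) ^ 3)⁻¹ * ∫ k : E3, φhat k := by
  rw [hA.eq_integral_cos x, abs_mul, abs_of_pos (by positivity)]
  gcongr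
  rw [← Real.norm_eq_abs]
  refine norm_integral_le_of_norm_le hA.integrable_hat (.of_forall fun k => ?_)
  rw [norm_mul, norm_of_nonneg (hA.nonneg k)]
  exact mul_le_of_le_one_right (hA.nonneg k) (abs_cos_le_one _)

end HypA

section Quadratic

variable {α F : Type*} [MeasurableSpace α] {μ : Measure α}
  [NormedAddCommGroup F] [InnerProductSpace ℝ F] {φ φhat : E3 → ℝ} {γ : α → E3} {v : α → F}

theorem integrable_smul_cos_inner (hγ : AEStronglyMeasurable γ μ) (hv : Integrable v μ) (k : E3) :
    Integrable (fun a => cos (inner ℝ k (γ a)) • v a) μ :=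
  hv.bdd_smul 1
    ((by fun_prop : Continuous fun x : E3 => cos (inner ℝ k x)).comp_aestronglyMeasurable hγ)
    (.of_forall fun _ => abs_cos_le_one _)

theorem integrable_smul_sin_inner (hγ : AEStronglyMeasurable γ μ) (hv : Integrable v μ) (k : E3) :
    Integrable (fun a => sin (inner ℝ k (γ a)) • v a) μ :=
  hv.bdd_smul 1
    ((by fun_prop : Continuous fun x : E3 => sin (inner ℝ k x)).comp_aestronglyMeasurable hγ)
    (.of_forall fun _ => abs_sin_le_one _)

theorem integrable_inner_prod {w : α → F} (hv : Integrable v μ) (hw : Integrable w μ) :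
    Integrable (fun p : α × α => (inner ℝ (v p.1) (w p.2) : ℝ)) (μ.prod μ) :=
  hv.op_fst_snd (op := fun a b => (inner ℝ a b : ℝ)) continuous_inner
    ⟨1, fun a b => by simpa using norm_inner_le_norm (𝕜 := ℝ) a b⟩ hw

theorem HypA.integrable_kernel_inner (hA : HypA φ φhat) (hγ : AEStronglyMeasurable γ μ)
    (hv : Integrable v μ) :
    Integrable (fun p : α × α => φ (γ p.1 - γ p.2) * (inner ℝ (v p.1) (v p.2) : ℝ))
      (μ.prod μ) :=
  (integrable_inner_prod hv hv).bdd_mul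
    (hA.cont.comp_aestronglyMeasurable (hγ.comp_fst.sub hγ.comp_snd))
    (.of_forall fun _ => hA.abs_le _)

variable [SFinite μ]

theorem integral_inner_prod_self_nonneg [CompleteSpace F] (hv : Integrable v μ) :
    0 ≤ ∫ p : α × α, (inner ℝ (v p.1) (v p.2) : ℝ) ∂μ.prod μ := by
  rw [integral_prod _ (integrable_inner_prod hv hv)]
  simp only [integral_inner hv]
  simp only [real_inner_comm (∫ x, v x ∂μ)]
  rw [integral_inner hv]
  exact real_inner_self_nonneg

theorem integral_cos_mul_inner_nonneg [CompleteSpace F] (hγ : AEStronglyMeasurable γ μ)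
    (hv : Integrable v μ) (k : E3) :
    0 ≤ ∫ p : α × α, cos (inner ℝ k (γ p.1 - γ p.2)) * (inner ℝ (v p.1) (v p.2) : ℝ)
      ∂μ.prod μ := by
  have hc := integrable_smul_cos_inner hγ hv k
  have hs := integrable_smul_sin_inner hγ hv k
  have hsplit : ∀ p : α × α,
      cos (inner ℝ k (γ p.1 - γ p.2)) * (inner ℝ (v p.1) (v p.2) : ℝ) =
        inner ℝ (cos (inner ℝ k (γ p.1)) • v p.1) (cos (inner ℝ k (γ p.2)) • v p.2) +
        inner ℝ (sin (inner ℝ k (γ p.1)) • v p.1) (sin (inner ℝ k (γ p.2)) • v p.2) := by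
    intro p
    simp only [inner_sub_right, cos_sub, real_inner_smul_left, real_inner_smul_right]
    ring
  simp only [hsplit]
  rw [integral_add (integrable_inner_prod hc hc) (integrable_inner_prod hs hs)]
  exact add_nonneg (integral_inner_prod_self_nonneg hc) (integral_inner_prod_self_nonneg hs)

/-- The kernel `φ (x - y)` is of positive type. -/
theorem HypA.integral_kernel_inner_nonneg [CompleteSpace F] (hA : HypA φ φhat)
    (hγ : AEStronglyMeasurable γ μ) (hv : Integrable v μ) :
    0 ≤ ∫ p : α × α, φ (γ p.1 - γ p.2) * (inner ℝ (v p.1) (v p.2) : ℝ) ∂μ.prod μ := by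
  have hint : Integrable (fun q : (α × α) × E3 =>
      cos (inner ℝ q.2 (γ q.1.1 - γ q.1.2)) *
        ((inner ℝ (v q.1.1) (v q.1.2) : ℝ) * φhat q.2)) ((μ.prod μ).prod volume) := by
    refine ((integrable_inner_prod hv hv).mul_prod hA.integrable_hat).bdd_mul (c := 1) ?_
      (.of_forall fun _ => abs_cos_le_one _)
    have hdiff : AEStronglyMeasurable (fun q : (α × α) × E3 => γ q.1.1 - γ q.1.2)
        ((μ.prod μ).prod volume) :=
      (hγ.comp_fst.sub hγ.comp_snd).comp_fst
    exact continuous_cos.comp_aestronglyMeasurable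
      (measurable_snd.aestronglyMeasurable.inner hdiff)
  have hkernel : ∀ p : α × α, φ (γ p.1 - γ p.2) * (inner ℝ (v p.1) (v p.2) : ℝ) =
      ((2 * π) ^ 3)⁻¹ * ∫ k : E3, cos (inner ℝ k (γ p.1 - γ p.2)) *
        ((inner ℝ (v p.1) (v p.2) : ℝ) * φhat k) := by
    intro p
    rw [hA.eq_integral_cos, mul_assoc, ← integral_mul_const]
    congr 2 with k
    ring
  simp only [hkernel]
  rw [integral_const_mul, integral_integral_swap hint]
  refine mul_nonneg (by positivity) (integral_nonneg fun k => ?_)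
  simp only [← mul_assoc, integral_mul_const]
  exact mul_nonneg (integral_cos_mul_inner_nonneg hγ hv k) (hA.nonneg k)

theorem HypA.integral_kernel_inner_le (hA : HypA φ φhat) (hγ : AEStronglyMeasurable γ μ)
    (hv : Integrable v μ) :
    ∫ p : α × α, φ (γ p.1 - γ p.2) * (inner ℝ (v p.1) (v p.2) : ℝ) ∂μ.prod μ ≤
      ((2 * π) ^ 3)⁻¹ * (∫ k : E3, φhat k) * (∫ a, ‖v a‖ ∂μ) ^ 2 := by
  rw [sq, ← integral_prod_mul, ← integral_const_mul]
  refine integral_mono (hA.integrable_kernel_inner hγ hv)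
    ((hv.norm.mul_prod hv.norm).const_mul _) fun p => ?_
  refine (le_abs_self _).trans ?_
  rw [abs_mul]
  exact mul_le_mul (hA.abs_le _) (abs_real_inner_le_norm _ _) (abs_nonneg _)
    ((abs_nonneg _).trans (hA.abs_le 0))

end Quadratic

namespace IsH1Loop

variable {γ γd : ℝ → E3}

theorem integrable_deriv (hγ : IsH1Loop γ γd) :
    Integrable γd (volume.restrict (Ioc (0:ℝ) 1)) :=
  hγ.memL2.integrable one_le_two

theorem aestronglyMeasurable (hγ : IsH1Loop γ γd) :
    AEStronglyMeasurable γ (volume.restrict (Ioc (0:ℝ) 1)) := by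
  have hint : IntervalIntegrable γd volume 0 1 :=
    (intervalIntegrable_iff_integrableOn_Ioc_of_le zero_le_one).2 hγ.integrable_deriv
  have hprim := intervalIntegral.continuousOn_primitive_interval' hint left_mem_uIcc
  rw [uIcc_of_le zero_le_one] at hprim
  have hcont : ContinuousOn γ (Icc 0 1) :=
    (continuousOn_const.add hprim).congr hγ.deriv_eq
  exact (hcont.mono Ioc_subset_Icc_self).aestronglyMeasurable measurableSet_Ioc

end IsH1Loop

theorem energy_eq_integral_prod {φ φhat : E3 → ℝ} (hA : HypA φ φhat) {γ γd : ℝ → E3}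
    (hγ : IsH1Loop γ γd) :
    energy φ γ γd = (1 / 2) * ∫ p : ℝ × ℝ, φ (γ p.1 - γ p.2) * (inner ℝ (γd p.1) (γd p.2) : ℝ)
      ∂(volume.restrict (Ioc (0:ℝ) 1)).prod (volume.restrict (Ioc (0:ℝ) 1)) := by
  rw [energy, integral_prod _ (hA.integrable_kernel_inner hγ.aestronglyMeasurable
    hγ.integrable_deriv)]
  simp only [intervalIntegral.integral_of_le zero_le_one]

/-- The energy of an `H¹` closed curve is well defined, nonnegative, and bounded by
`(1/(2(2π)³)) (∫ φ̂(k) dk) (∫₀¹ |γ'(ξ)| dξ)²`. -/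
theorem energy_nonneg_and_bounded (φ φhat : E3 → ℝ) (hA : HypA φ φhat)
    (γ γd : ℝ → E3) (hγ : IsH1Loop γ γd) :
    0 ≤ energy φ γ γd ∧
      energy φ γ γd ≤
        (1 / (2 * (2 * π) ^ 3)) * (∫ k : E3, φhat k) *
          (∫ ξ in (0:ℝ)..1, ‖γd ξ‖) ^ 2 := by
  rw [energy_eq_integral_prod hA hγ, intervalIntegral.integral_of_le zero_le_one]
  have hm := hγ.aestronglyMeasurable
  have hv := hγ.integrable_deriv
  refine ⟨mul_nonneg (by norm_num) (hA.integral_kernel_inner_nonneg hm hv), ?_⟩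
  calc _ ≤ (1 / 2) * _ :=
        mul_le_mul_of_nonneg_left (hA.integral_kernel_inner_le hm hv) (by norm_num)
    _ = _ := by
      rw [one_div_mul_eq_div, one_div, mul_inv]
      ring
end
end

section
/- Assume Hypothesis A and that φ is twice continuously differentiable. Let T > 0 and let γ : [0,T] × [0,1] → ℝ³ be continuously differentiable in (t,ξ) with γ(t,0) = γ(t,1) for all t, and suppose γ solves the regularized filament equation ∂_tγ(t,ξ) = u_t(γ(t,ξ)), where u_t(x) = ∫₀¹ ∇φ(x − γ(t,η)) ∧ ∂_ηγ(t,η) dη. Then the energy is conserved: t ↦ H(γ(t,·)) is constant on [0,T]. -/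
noncomputable section
open MeasureTheory Real Set

section ParametricIntegral

variable {E : Type*} [NormedAddCommGroup E] [NormedSpace ℝ E]

/-- Differentiation under the integral sign over a compact interval, for an integrand that is
continuous together with its partial derivative in the parameter. -/
theorem hasDerivAt_intervalIntegral_of_continuous {F F' : ℝ → ℝ → E}
    (hF : Continuous fun p : ℝ × ℝ => F p.1 p.2) (hF' : Continuous fun p : ℝ × ℝ => F' p.1 p.2)
    (h : ∀ x s, HasDerivAt (fun y => F y s) (F' x s) x) (a b x : ℝ) :
    HasDerivAt (fun y => ∫ s in a..b, F y s) (∫ s in a..b, F' x s) x := by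
  obtain ⟨C, hC⟩ := ((isCompact_closedBall x 1).prod
    (isCompact_uIcc (a := a) (b := b))).exists_bound_of_continuousOn hF'.continuousOn
  have hFx : ∀ y, Continuous (F y) := fun y => hF.comp (Continuous.prodMk_right y)
  have hFx' : ∀ y, Continuous (F' y) := fun y => hF'.comp (Continuous.prodMk_right y)
  refine (intervalIntegral.hasDerivAt_integral_of_dominated_loc_of_deriv_le
    (bound := fun _ => C) (Metric.closedBall_mem_nhds x one_pos) ?_ ?_ ?_ ?_ ?_ ?_).2
  · exact Filter.Eventually.of_forall fun y => (hFx y).aestronglyMeasurable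
  · exact (hFx x).intervalIntegrable _ _
  · exact (hFx' x).aestronglyMeasurable
  · exact Filter.Eventually.of_forall fun s hs y hy => hC (y, s) ⟨hy, Set.uIoc_subset_uIcc hs⟩
  · exact intervalIntegrable_const
  · exact Filter.Eventually.of_forall fun s _ y _ => h y s

theorem intervalIntegral_swap_of_continuous {f : ℝ → ℝ → E}
    (hf : Continuous fun p : ℝ × ℝ => f p.1 p.2) (a b c d : ℝ) :
    ∫ x in a..b, ∫ y in c..d, f x y = ∫ y in c..d, ∫ x in a..b, f x y := by
  refine intervalIntegral_intervalIntegral_swap ?_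
  exact (hf.continuousOn.integrableOn_compact (isCompact_uIcc.prod isCompact_uIcc)).mono_set
    (prod_mono Set.uIoc_subset_uIcc Set.uIoc_subset_uIcc)

end ParametricIntegral

section CrossProduct

theorem continuous_cross3 : Continuous fun p : E3 × E3 => cross3 p.1 p.2 := by
  unfold cross3
  refine (PiLp.continuous_toLp 2 _).comp (continuous_pi fun i => ?_)
  fin_cases i <;> simp [cross_apply] <;> fun_prop

/-- The cross product with a fixed right factor, as a continuous linear map. -/
def crossRight (b : E3) : E3 →L[ℝ] E3 :=
  LinearMap.toContinuousLinearMap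
    { toFun := fun a => cross3 a b
      map_add' := fun x y => by simp [cross3]
      map_smul' := fun c x => by simp [cross3] }

theorem inner_cross3_cross3 (a b c d : E3) :
    (inner ℝ (cross3 a b) (cross3 c d) : ℝ) =
      inner ℝ c a * inner ℝ b d - inner ℝ c b * inner ℝ a d := by
  simp [cross3, cross_apply, PiLp.inner_apply, Fin.sum_univ_three]
  ring

theorem inner_cross3_self (a b : E3) : (inner ℝ (cross3 a b) a : ℝ) = 0 := by
  simp [cross3, cross_apply, PiLp.inner_apply, Fin.sum_univ_three]
  ring

end CrossProduct

section Gradient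

variable {φ : E3 → ℝ}

theorem contDiff_gradient (hφ : ContDiff ℝ 2 φ) : ContDiff ℝ 1 (gradient φ) :=
  (InnerProductSpace.toDual ℝ E3).symm.contDiff.comp (hφ.fderiv_right (by norm_num))

theorem hasDerivAt_comp_gradient (hφ : ContDiff ℝ 2 φ) {f : ℝ → E3} {f' : E3} {x : ℝ}
    (hf : HasDerivAt f f' x) :
    HasDerivAt (fun y => φ (f y)) (inner ℝ (gradient φ (f x)) f') x := by
  exact (hφ.differentiable two_ne_zero (f x)).hasGradientAt.hasFDerivAt.comp_hasDerivAt x hf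

theorem gradient_neg_of_even (heven : ∀ x, φ (-x) = φ x) (x : E3) :
    gradient φ (-x) = -gradient φ x := by
  have h : fderiv ℝ φ (-x) = -fderiv ℝ φ x := by
    have h := fderiv_comp_smul (𝕜 := ℝ) (f := φ) (x := x) (-1 : ℝ)
    simpa [heven] using congrArg Neg.neg h.symm
  simp [gradient, h]

end Gradient

section Filament

variable {φ : E3 → ℝ} {γ : ℝ → ℝ → E3}

theorem hasDerivAt_curve (hγ : ContDiff ℝ 1 fun p : ℝ × ℝ => γ p.1 p.2) (t ξ : ℝ) :
    HasDerivAt (γ t) (deriv (γ t) ξ) ξ := by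
  have : Differentiable ℝ (γ t) :=
    (hγ.comp (contDiff_prodMk_right t)).differentiable one_ne_zero
  exact (this ξ).hasDerivAt

theorem hasDerivAt_time (hγ : ContDiff ℝ 1 fun p : ℝ × ℝ => γ p.1 p.2) (t ξ : ℝ) :
    HasDerivAt (fun s => γ s ξ) (deriv (fun s => γ s ξ) t) t := by
  have : Differentiable ℝ (fun s => γ s ξ) :=
    (hγ.comp (contDiff_prodMk_left ξ)).differentiable one_ne_zero
  exact (this t).hasDerivAt

theorem continuous_deriv_curve (hγ : ContDiff ℝ 1 fun p : ℝ × ℝ => γ p.1 p.2) :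
    Continuous fun p : ℝ × ℝ => deriv (γ p.1) p.2 := by
  have h : (fun p : ℝ × ℝ => deriv (γ p.1) p.2) =
      fun p => fderiv ℝ (fun p : ℝ × ℝ => γ p.1 p.2) p (0, 1) := by
    ext1 p
    refine HasDerivAt.deriv ?_
    exact (hγ.differentiable one_ne_zero p).hasFDerivAt.comp_hasDerivAt p.2
      ((hasDerivAt_const p.2 p.1).prodMk (hasDerivAt_id p.2))
  rw [h]
  exact (hγ.continuous_fderiv one_ne_zero).clm_apply continuous_const

theorem continuous_deriv_time (hγ : ContDiff ℝ 1 fun p : ℝ × ℝ => γ p.1 p.2) :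
    Continuous fun p : ℝ × ℝ => deriv (fun s => γ s p.2) p.1 := by
  have h : (fun p : ℝ × ℝ => deriv (fun s => γ s p.2) p.1) =
      fun p => fderiv ℝ (fun p : ℝ × ℝ => γ p.1 p.2) p (1, 0) := by
    ext1 p
    refine HasDerivAt.deriv ?_
    exact (hγ.differentiable one_ne_zero p).hasFDerivAt.comp_hasDerivAt p.1
      ((hasDerivAt_id p.1).prodMk (hasDerivAt_const p.1 p.2))
  rw [h]
  exact (hγ.continuous_fderiv one_ne_zero).clm_apply continuous_const

/-- The induced velocity of the curve `γ t` along the curve itself. -/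
def selfVelocity (φ : E3 → ℝ) (γ : ℝ → ℝ → E3) (t ξ : ℝ) : E3 :=
  velocity φ (γ t) (deriv (γ t)) (γ t ξ)

/-- The derivative of `selfVelocity` in the curve parameter. -/
def selfVelocityDeriv (φ : E3 → ℝ) (γ : ℝ → ℝ → E3) (t ξ : ℝ) : E3 :=
  ∫ η in (0:ℝ)..1,
    cross3 (fderiv ℝ (gradient φ) (γ t ξ - γ t η) (deriv (γ t) ξ)) (deriv (γ t) η)

/-- The primitive in time of `selfVelocityDeriv` with value `∂_ξ γ` at time zero. -/
def tangent (φ : E3 → ℝ) (γ : ℝ → ℝ → E3) (t ξ : ℝ) : E3 :=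
  deriv (γ 0) ξ + ∫ r in (0:ℝ)..t, selfVelocityDeriv φ γ r ξ

theorem continuous_velocity_integrand (hφ : ContDiff ℝ 2 φ)
    (hγ : ContDiff ℝ 1 fun p : ℝ × ℝ => γ p.1 p.2) :
    Continuous fun p : (ℝ × ℝ) × ℝ =>
      cross3 (gradient φ (γ p.1.1 p.1.2 - γ p.1.1 p.2)) (deriv (γ p.1.1) p.2) := by
  have hc := hγ.continuous
  have hw := continuous_deriv_curve hγ
  have h1 : Continuous fun p : (ℝ × ℝ) × ℝ => γ p.1.1 p.1.2 := hc.comp continuous_fst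
  have h2 : Continuous fun p : (ℝ × ℝ) × ℝ => γ p.1.1 p.2 :=
    hc.comp (f := fun p : (ℝ × ℝ) × ℝ => (p.1.1, p.2)) (by fun_prop)
  have h3 : Continuous fun p : (ℝ × ℝ) × ℝ => deriv (γ p.1.1) p.2 :=
    hw.comp (f := fun p : (ℝ × ℝ) × ℝ => (p.1.1, p.2)) (by fun_prop)
  exact continuous_cross3.comp
    (((contDiff_gradient hφ).continuous.comp (h1.sub h2)).prodMk h3)

theorem continuous_velocityDeriv_integrand (hφ : ContDiff ℝ 2 φ)
    (hγ : ContDiff ℝ 1 fun p : ℝ × ℝ => γ p.1 p.2) :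
    Continuous fun p : (ℝ × ℝ) × ℝ =>
      cross3 (fderiv ℝ (gradient φ) (γ p.1.1 p.1.2 - γ p.1.1 p.2) (deriv (γ p.1.1) p.1.2))
        (deriv (γ p.1.1) p.2) := by
  have hc := hγ.continuous
  have hw := continuous_deriv_curve hγ
  have h1 : Continuous fun p : (ℝ × ℝ) × ℝ => γ p.1.1 p.1.2 := hc.comp continuous_fst
  have h2 : Continuous fun p : (ℝ × ℝ) × ℝ => γ p.1.1 p.2 :=
    hc.comp (f := fun p : (ℝ × ℝ) × ℝ => (p.1.1, p.2)) (by fun_prop)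
  have h3 : Continuous fun p : (ℝ × ℝ) × ℝ => deriv (γ p.1.1) p.2 :=
    hw.comp (f := fun p : (ℝ × ℝ) × ℝ => (p.1.1, p.2)) (by fun_prop)
  have h4 : Continuous fun p : (ℝ × ℝ) × ℝ => deriv (γ p.1.1) p.1.2 := hw.comp continuous_fst
  exact continuous_cross3.comp (((((contDiff_gradient hφ).continuous_fderiv one_ne_zero).comp
    (h1.sub h2)).clm_apply h4).prodMk h3)

theorem continuous_selfVelocity (hφ : ContDiff ℝ 2 φ)
    (hγ : ContDiff ℝ 1 fun p : ℝ × ℝ => γ p.1 p.2) :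
    Continuous fun p : ℝ × ℝ => selfVelocity φ γ p.1 p.2 :=
  intervalIntegral.continuous_parametric_intervalIntegral_of_continuous'
    (continuous_velocity_integrand hφ hγ) 0 1

theorem continuous_selfVelocityDeriv (hφ : ContDiff ℝ 2 φ)
    (hγ : ContDiff ℝ 1 fun p : ℝ × ℝ => γ p.1 p.2) :
    Continuous fun p : ℝ × ℝ => selfVelocityDeriv φ γ p.1 p.2 :=
  intervalIntegral.continuous_parametric_intervalIntegral_of_continuous'
    (continuous_velocityDeriv_integrand hφ hγ) 0 1

theorem hasDerivAt_selfVelocity (hφ : ContDiff ℝ 2 φ)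
    (hγ : ContDiff ℝ 1 fun p : ℝ × ℝ => γ p.1 p.2) (t ξ : ℝ) :
    HasDerivAt (selfVelocity φ γ t) (selfVelocityDeriv φ γ t ξ) ξ := by
  have hm : Continuous fun p : ℝ × ℝ => ((t, p.1), p.2) := by fun_prop
  refine hasDerivAt_intervalIntegral_of_continuous
    (F := fun ξ η => cross3 (gradient φ (γ t ξ - γ t η)) (deriv (γ t) η))
    (F' := fun ξ η =>
      cross3 (fderiv ℝ (gradient φ) (γ t ξ - γ t η) (deriv (γ t) ξ)) (deriv (γ t) η))
    ((continuous_velocity_integrand hφ hγ).comp (f := fun p : ℝ × ℝ => ((t, p.1), p.2)) hm)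
    ((continuous_velocityDeriv_integrand hφ hγ).comp (f := fun p : ℝ × ℝ => ((t, p.1), p.2)) hm)
    (fun x s => ?_) 0 1 ξ
  have h1 := (hasDerivAt_curve hγ t x).sub_const (γ t s)
  have h2 := (((contDiff_gradient hφ).differentiable one_ne_zero)
    (γ t x - γ t s)).hasFDerivAt.comp_hasDerivAt x h1
  exact (crossRight (deriv (γ t) s)).hasFDerivAt.comp_hasDerivAt x h2

theorem continuous_tangent (hφ : ContDiff ℝ 2 φ)
    (hγ : ContDiff ℝ 1 fun p : ℝ × ℝ => γ p.1 p.2) :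
    Continuous fun p : ℝ × ℝ => tangent φ γ p.1 p.2 := by
  have hV' := continuous_selfVelocityDeriv hφ hγ
  have hw := continuous_deriv_curve hγ
  refine Continuous.add (hw.comp (f := fun p : ℝ × ℝ => ((0 : ℝ), p.2)) (by fun_prop)) ?_
  exact intervalIntegral.continuous_parametric_intervalIntegral_of_continuous
    (f := fun (p : ℝ × ℝ) r => selfVelocityDeriv φ γ r p.2)
    (hV'.comp (f := fun q : (ℝ × ℝ) × ℝ => (q.2, q.1.2)) (by fun_prop)) continuous_fst

theorem hasDerivAt_tangent (hφ : ContDiff ℝ 2 φ)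
    (hγ : ContDiff ℝ 1 fun p : ℝ × ℝ => γ p.1 p.2) (t ξ : ℝ) :
    HasDerivAt (fun s => tangent φ γ s ξ) (selfVelocityDeriv φ γ t ξ) t := by
  unfold tangent
  have hV' : Continuous fun r => selfVelocityDeriv φ γ r ξ :=
    (continuous_selfVelocityDeriv hφ hγ).comp (f := fun r => (r, ξ)) (Continuous.prodMk_left ξ)
  exact (hV'.integral_hasStrictDerivAt 0 t).hasDerivAt.const_add (deriv (γ 0) ξ)

attribute [irreducible] selfVelocity selfVelocityDeriv tangent

/-- Along a solution, the mixed derivative `∂_t ∂_ξ γ` exists and is `selfVelocityDeriv`. -/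
theorem deriv_eq_tangent (hφ : ContDiff ℝ 2 φ)
    (hγ : ContDiff ℝ 1 fun p : ℝ × ℝ => γ p.1 p.2) {T : ℝ}
    (heq : ∀ t ∈ Icc (0:ℝ) T, ∀ ξ ∈ Icc (0:ℝ) 1,
      deriv (fun s => γ s ξ) t = selfVelocity φ γ t ξ)
    {t ξ : ℝ} (ht : t ∈ Icc (0:ℝ) T) (hξ : ξ ∈ Icc (0:ℝ) 1) :
    deriv (γ t) ξ = tangent φ γ t ξ := by
  have hV := continuous_selfVelocity hφ hγ
  have hV' := continuous_selfVelocityDeriv hφ hγ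
  have hzero : ∀ x ∈ Icc (0:ℝ) 1, γ t x - γ 0 x - ∫ r in (0:ℝ)..t, selfVelocity φ γ r x = 0 := by
    intro x hx
    have h1 : ∫ r in (0:ℝ)..t, deriv (fun s => γ s x) r = γ t x - γ 0 x :=
      intervalIntegral.integral_eq_sub_of_hasDerivAt (fun r _ => hasDerivAt_time hγ r x)
        (((continuous_deriv_time hγ).comp (f := fun r => (r, x))
          (Continuous.prodMk_left x)).intervalIntegrable _ _)
    rw [← h1, sub_eq_zero]
    refine intervalIntegral.integral_congr fun r hr => ?_
    rw [uIcc_of_le ht.1] at hr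
    exact heq r ⟨hr.1, hr.2.trans ht.2⟩ x hx
  have hI : HasDerivAt (fun x => ∫ r in (0:ℝ)..t, selfVelocity φ γ r x)
      (∫ r in (0:ℝ)..t, selfVelocityDeriv φ γ r ξ) ξ :=
    hasDerivAt_intervalIntegral_of_continuous
      (F := fun x r => selfVelocity φ γ r x) (F' := fun x r => selfVelocityDeriv φ γ r x)
      (hV.comp continuous_swap) (hV'.comp continuous_swap)
      (fun x r => hasDerivAt_selfVelocity hφ hγ r x) 0 t ξ
  have hg := (((hasDerivAt_curve hγ t ξ).sub (hasDerivAt_curve hγ 0 ξ)).sub hI).hasDerivWithinAt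
    (s := Icc (0:ℝ) 1)
  have h0 : HasDerivWithinAt
      (fun x => γ t x - γ 0 x - ∫ r in (0:ℝ)..t, selfVelocity φ γ r x) 0 (Icc (0:ℝ) 1) ξ :=
    (hasDerivWithinAt_const ξ _ (0 : E3)).congr hzero (hzero ξ hξ)
  have := (uniqueDiffOn_Icc (zero_lt_one' ℝ) ξ hξ).eq_deriv _ hg h0
  rw [tangent, ← sub_eq_zero, ← this]
  abel

/-- Half of the time derivative of the energy density. -/
def energyRate (φ : E3 → ℝ) (γ : ℝ → ℝ → E3) (t ξ η : ℝ) : ℝ :=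
  inner ℝ (gradient φ (γ t ξ - γ t η)) (deriv (fun s => γ s ξ) t) *
      inner ℝ (tangent φ γ t ξ) (tangent φ γ t η) +
    φ (γ t ξ - γ t η) * inner ℝ (selfVelocityDeriv φ γ t ξ) (tangent φ γ t η)

theorem continuous_energyRate (hφ : ContDiff ℝ 2 φ)
    (hγ : ContDiff ℝ 1 fun p : ℝ × ℝ => γ p.1 p.2) :
    Continuous fun p : ℝ × ℝ × ℝ => energyRate φ γ p.1 p.2.1 p.2.2 := by
  have hξ : Continuous fun p : ℝ × ℝ × ℝ => (p.1, p.2.1) := by fun_prop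
  have hη : Continuous fun p : ℝ × ℝ × ℝ => (p.1, p.2.2) := by fun_prop
  have hd := (hγ.continuous.comp hξ).sub (hγ.continuous.comp hη)
  have hW := continuous_tangent hφ hγ
  exact ((((contDiff_gradient hφ).continuous.comp hd).inner
      ((continuous_deriv_time hγ).comp hξ)).mul ((hW.comp hξ).inner (hW.comp hη))).add
    ((hφ.continuous.comp hd).mul
      (((continuous_selfVelocityDeriv hφ hγ).comp hξ).inner (hW.comp hη)))

theorem hasDerivAt_energyDensity (heven : ∀ x, φ (-x) = φ x) (hφ : ContDiff ℝ 2 φ)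
    (hγ : ContDiff ℝ 1 fun p : ℝ × ℝ => γ p.1 p.2) (t ξ η : ℝ) :
    HasDerivAt
      (fun s => φ (γ s ξ - γ s η) * (inner ℝ (tangent φ γ s ξ) (tangent φ γ s η) : ℝ))
      (energyRate φ γ t ξ η + energyRate φ γ t η ξ) t := by
  have h1 := hasDerivAt_comp_gradient hφ
    ((hasDerivAt_time hγ t ξ).sub (hasDerivAt_time hγ t η))
  have h2 := (hasDerivAt_tangent hφ hγ t ξ).inner ℝ (hasDerivAt_tangent hφ hγ t η)
  refine (h1.mul h2).congr_deriv ?_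
  have h3 : gradient φ (γ t η - γ t ξ) = -gradient φ (γ t ξ - γ t η) := by
    rw [← gradient_neg_of_even heven, neg_sub]
  have h4 : φ (γ t η - γ t ξ) = φ (γ t ξ - γ t η) := by rw [← heven, neg_sub]
  simp only [energyRate, h3, h4, inner_sub_right, inner_neg_left, Pi.sub_apply,
    real_inner_comm (tangent φ γ t ξ)]
  ring

attribute [irreducible] energyRate

theorem hasDerivAt_energy_tangent (heven : ∀ x, φ (-x) = φ x) (hφ : ContDiff ℝ 2 φ)
    (hγ : ContDiff ℝ 1 fun p : ℝ × ℝ => γ p.1 p.2) (t : ℝ) :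
    HasDerivAt (fun s => energy φ (γ s) (tangent φ γ s))
      (∫ η in (0:ℝ)..1, ∫ ξ in (0:ℝ)..1, energyRate φ γ t ξ η) t := by
  unfold energy
  have hR := continuous_energyRate hφ hγ
  have hW := continuous_tangent hφ hγ
  have hden : Continuous fun p : (ℝ × ℝ) × ℝ => φ (γ p.1.1 p.1.2 - γ p.1.1 p.2) *
      (inner ℝ (tangent φ γ p.1.1 p.1.2) (tangent φ γ p.1.1 p.2) : ℝ) := by
    have hξ : Continuous fun p : (ℝ × ℝ) × ℝ => (p.1.1, p.1.2) := by fun_prop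
    have hη : Continuous fun p : (ℝ × ℝ) × ℝ => (p.1.1, p.2) := by fun_prop
    exact (hφ.continuous.comp ((hγ.continuous.comp hξ).sub (hγ.continuous.comp hη))).mul
      ((hW.comp hξ).inner (hW.comp hη))
  have hsum : Continuous fun p : (ℝ × ℝ) × ℝ =>
      energyRate φ γ p.1.1 p.1.2 p.2 + energyRate φ γ p.1.1 p.2 p.1.2 :=
    (hR.comp (f := fun p : (ℝ × ℝ) × ℝ => (p.1.1, p.1.2, p.2)) (by fun_prop)).add
      (hR.comp (f := fun p : (ℝ × ℝ) × ℝ => (p.1.1, p.2, p.1.2)) (by fun_prop))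
  have hinner : ∀ s ξ, HasDerivAt
      (fun s => ∫ η in (0:ℝ)..1, φ (γ s ξ - γ s η) *
        (inner ℝ (tangent φ γ s ξ) (tangent φ γ s η) : ℝ))
      (∫ η in (0:ℝ)..1, (energyRate φ γ s ξ η + energyRate φ γ s η ξ)) s := fun s ξ =>
    hasDerivAt_intervalIntegral_of_continuous
      (F := fun s η => φ (γ s ξ - γ s η) * (inner ℝ (tangent φ γ s ξ) (tangent φ γ s η) : ℝ))
      (F' := fun s η => energyRate φ γ s ξ η + energyRate φ γ s η ξ)
      (hden.comp (f := fun p : ℝ × ℝ => ((p.1, ξ), p.2)) (by fun_prop))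
      (hsum.comp (f := fun p : ℝ × ℝ => ((p.1, ξ), p.2)) (by fun_prop))
      (fun s η => hasDerivAt_energyDensity heven hφ hγ s ξ η) 0 1 s
  have houter := (hasDerivAt_intervalIntegral_of_continuous
    (F := fun s ξ => ∫ η in (0:ℝ)..1, φ (γ s ξ - γ s η) *
      (inner ℝ (tangent φ γ s ξ) (tangent φ γ s η) : ℝ))
    (F' := fun s ξ => ∫ η in (0:ℝ)..1, (energyRate φ γ s ξ η + energyRate φ γ s η ξ))
    (intervalIntegral.continuous_parametric_intervalIntegral_of_continuous' (f := fun (p : ℝ × ℝ) η =>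
      φ (γ p.1 p.2 - γ p.1 η) * (inner ℝ (tangent φ γ p.1 p.2) (tangent φ γ p.1 η) : ℝ)) hden 0 1)
    (intervalIntegral.continuous_parametric_intervalIntegral_of_continuous' (f := fun (p : ℝ × ℝ) η =>
      energyRate φ γ p.1 p.2 η + energyRate φ γ p.1 η p.2) hsum 0 1)
    hinner 0 1 t).const_mul (1 / 2 : ℝ)
  refine houter.congr_deriv ?_
  have hRt : Continuous fun p : ℝ × ℝ => energyRate φ γ t p.1 p.2 :=
    hR.comp (f := fun p : ℝ × ℝ => (t, p.1, p.2)) (by fun_prop)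
  have hRt' : Continuous fun p : ℝ × ℝ => energyRate φ γ t p.2 p.1 := hRt.comp continuous_swap
  have hsplit : ∀ ξ, ∫ η in (0:ℝ)..1, (energyRate φ γ t ξ η + energyRate φ γ t η ξ) =
      (∫ η in (0:ℝ)..1, energyRate φ γ t ξ η) + ∫ η in (0:ℝ)..1, energyRate φ γ t η ξ :=
    fun ξ => intervalIntegral.integral_add
      ((hRt.comp (f := fun η => (ξ, η)) (Continuous.prodMk_right ξ)).intervalIntegrable _ _)
      ((hRt.comp (f := fun r => (r, ξ)) (Continuous.prodMk_left ξ)).intervalIntegrable _ _)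
  have hI : Continuous fun ξ => ∫ η in (0:ℝ)..1, energyRate φ γ t ξ η :=
    intervalIntegral.continuous_parametric_intervalIntegral_of_continuous'
      (f := fun ξ η => energyRate φ γ t ξ η) hRt 0 1
  have hI' : Continuous fun ξ => ∫ η in (0:ℝ)..1, energyRate φ γ t η ξ :=
    intervalIntegral.continuous_parametric_intervalIntegral_of_continuous'
      (f := fun ξ η => energyRate φ γ t η ξ) hRt' 0 1
  simp only [hsplit]
  rw [intervalIntegral.integral_add
    (hI.intervalIntegrable _ _) (hI'.intervalIntegrable _ _),
    intervalIntegral_swap_of_continuous hRt]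
  ring

/-- Integration by parts in the curve parameter on a closed curve. -/
theorem integral_energyRate (hφ : ContDiff ℝ 2 φ)
    (hγ : ContDiff ℝ 1 fun p : ℝ × ℝ => γ p.1 p.2) {T : ℝ}
    (hclosed : ∀ t ∈ Icc (0:ℝ) T, γ t 0 = γ t 1)
    (heq : ∀ t ∈ Icc (0:ℝ) T, ∀ ξ ∈ Icc (0:ℝ) 1,
      deriv (fun s => γ s ξ) t = selfVelocity φ γ t ξ)
    {t η : ℝ} (ht : t ∈ Icc (0:ℝ) T) (hη : η ∈ Icc (0:ℝ) 1) :
    ∫ ξ in (0:ℝ)..1, energyRate φ γ t ξ η =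
      ∫ ξ in (0:ℝ)..1, (inner ℝ (cross3 (selfVelocity φ γ t ξ) (deriv (γ t) ξ))
        (cross3 (gradient φ (γ t ξ - γ t η)) (deriv (γ t) η)) : ℝ) := by
  set b := deriv (γ t) η with hb
  have hmk : Continuous fun ξ : ℝ => (t, ξ) := Continuous.prodMk_right t
  have hc : Continuous fun ξ => γ t ξ - γ t η :=
    (hγ.continuous.comp (f := fun ξ : ℝ => (t, ξ)) hmk).sub continuous_const
  have hG := (contDiff_gradient hφ).continuous.comp hc
  have hw : Continuous (deriv (γ t)) := (continuous_deriv_curve hγ).comp (f := fun ξ : ℝ => (t, ξ)) hmk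
  have hV : Continuous (selfVelocity φ γ t) :=
    (continuous_selfVelocity hφ hγ).comp (f := fun ξ : ℝ => (t, ξ)) hmk
  have hV' : Continuous (selfVelocityDeriv φ γ t) :=
    (continuous_selfVelocityDeriv hφ hγ).comp (f := fun ξ : ℝ => (t, ξ)) hmk
  have hder : ∀ ξ, HasDerivAt
      (fun ξ => φ (γ t ξ - γ t η) * (inner ℝ (selfVelocity φ γ t ξ) b : ℝ))
      (inner ℝ (gradient φ (γ t ξ - γ t η)) (deriv (γ t) ξ) * inner ℝ (selfVelocity φ γ t ξ) b +
        φ (γ t ξ - γ t η) * inner ℝ (selfVelocityDeriv φ γ t ξ) b) ξ := fun ξ => by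
    have h1 := hasDerivAt_comp_gradient hφ ((hasDerivAt_curve hγ t ξ).sub_const (γ t η))
    have h2 := (hasDerivAt_selfVelocity hφ hγ t ξ).inner ℝ (hasDerivAt_const ξ b)
    refine (h1.mul h2).congr_deriv ?_
    rw [inner_zero_right, zero_add]
  have hcd : Continuous fun ξ =>
      inner ℝ (gradient φ (γ t ξ - γ t η)) (deriv (γ t) ξ) * inner ℝ (selfVelocity φ γ t ξ) b +
        φ (γ t ξ - γ t η) * inner ℝ (selfVelocityDeriv φ γ t ξ) b :=
    ((hG.inner hw).mul (hV.inner continuous_const)).add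
      ((hφ.continuous.comp hc).mul (hV'.inner continuous_const))
  have hzero := intervalIntegral.integral_eq_sub_of_hasDerivAt (fun ξ _ => hder ξ)
    (hcd.intervalIntegrable 0 1)
  have hends : selfVelocity φ γ t 0 = selfVelocity φ γ t 1 := by
    simp only [selfVelocity, hclosed t ht]
  rw [hends, hclosed t ht, sub_self] at hzero
  have hcross : Continuous fun ξ => (inner ℝ (cross3 (selfVelocity φ γ t ξ) (deriv (γ t) ξ))
      (cross3 (gradient φ (γ t ξ - γ t η)) b) : ℝ) :=
    (continuous_cross3.comp (hV.prodMk hw)).inner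
      (continuous_cross3.comp (hG.prodMk continuous_const))
  refine Eq.trans ?_ (add_zero _)
  nth_rewrite 3 [← hzero]
  rw [← intervalIntegral.integral_add (hcross.intervalIntegrable _ _) (hcd.intervalIntegrable _ _)]
  refine intervalIntegral.integral_congr fun ξ hξ => ?_
  rw [uIcc_of_le zero_le_one] at hξ
  simp only [energyRate, inner_cross3_cross3, heq t ht ξ hξ, ← deriv_eq_tangent hφ hγ heq ht hξ,
    ← deriv_eq_tangent hφ hγ heq ht hη, ← hb]
  ring

theorem integral_integral_energyRate (hφ : ContDiff ℝ 2 φ)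
    (hγ : ContDiff ℝ 1 fun p : ℝ × ℝ => γ p.1 p.2) {T : ℝ}
    (hclosed : ∀ t ∈ Icc (0:ℝ) T, γ t 0 = γ t 1)
    (heq : ∀ t ∈ Icc (0:ℝ) T, ∀ ξ ∈ Icc (0:ℝ) 1,
      deriv (fun s => γ s ξ) t = selfVelocity φ γ t ξ)
    {t : ℝ} (ht : t ∈ Icc (0:ℝ) T) :
    ∫ η in (0:ℝ)..1, ∫ ξ in (0:ℝ)..1, energyRate φ γ t ξ η = 0 := by
  have hint : Continuous fun p : ℝ × ℝ =>
      cross3 (gradient φ (γ t p.2 - γ t p.1)) (deriv (γ t) p.1) :=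
    (continuous_velocity_integrand hφ hγ).comp (f := fun p : ℝ × ℝ => ((t, p.2), p.1))
      (by fun_prop)
  have hleft : Continuous fun p : ℝ × ℝ => cross3 (selfVelocity φ γ t p.2) (deriv (γ t) p.2) := by
    have hmk : Continuous fun p : ℝ × ℝ => (t, p.2) := by fun_prop
    exact continuous_cross3.comp
      (((continuous_selfVelocity hφ hγ).comp (f := fun p : ℝ × ℝ => (t, p.2)) hmk).prodMk
      ((continuous_deriv_curve hγ).comp (f := fun p : ℝ × ℝ => (t, p.2)) hmk))
  calc ∫ η in (0:ℝ)..1, ∫ ξ in (0:ℝ)..1, energyRate φ γ t ξ η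
      = ∫ η in (0:ℝ)..1, ∫ ξ in (0:ℝ)..1,
          (inner ℝ (cross3 (selfVelocity φ γ t ξ) (deriv (γ t) ξ))
            (cross3 (gradient φ (γ t ξ - γ t η)) (deriv (γ t) η)) : ℝ) := by
        refine intervalIntegral.integral_congr fun η hη => ?_
        rw [uIcc_of_le zero_le_one] at hη
        exact integral_energyRate hφ hγ hclosed heq ht hη
    _ = ∫ ξ in (0:ℝ)..1, ∫ η in (0:ℝ)..1,
          (inner ℝ (cross3 (selfVelocity φ γ t ξ) (deriv (γ t) ξ))
            (cross3 (gradient φ (γ t ξ - γ t η)) (deriv (γ t) η)) : ℝ) :=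
        intervalIntegral_swap_of_continuous (hleft.inner hint) 0 1 0 1
    _ = ∫ ξ in (0:ℝ)..1,
          (inner ℝ (cross3 (selfVelocity φ γ t ξ) (deriv (γ t) ξ)) (selfVelocity φ γ t ξ) : ℝ) := by
        refine intervalIntegral.integral_congr fun ξ _ => ?_
        have hη : Continuous fun η => cross3 (gradient φ (γ t ξ - γ t η)) (deriv (γ t) η) :=
          hint.comp (f := fun r => (r, ξ)) (Continuous.prodMk_left ξ)
        have hc : ∀ c : E3, ∫ η in (0:ℝ)..1, (inner ℝ c
            (cross3 (gradient φ (γ t ξ - γ t η)) (deriv (γ t) η)) : ℝ) =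
            inner ℝ c (selfVelocity φ γ t ξ) := fun c => by
          rw [selfVelocity, velocity]
          exact (innerSL ℝ c).intervalIntegral_comp_comm (hη.intervalIntegrable 0 1)
        exact hc _
    _ = 0 := by simp [inner_cross3_self]

end Filament

/-- Conservation of the energy along `C¹` solutions of the regularized vortex
filament equation `∂ₜγ(t,ξ) = uₜ(γ(t,ξ))`, `uₜ(x) = ∫₀¹ ∇φ(x-γ(t,η)) ∧ ∂_ηγ(t,η) dη`. -/
theorem energy_conservation (φ φhat : E3 → ℝ) (hA : HypA φ φhat)
    (hφ2 : ContDiff ℝ 2 φ) (T : ℝ) (hT : 0 < T) (γ : ℝ → ℝ → E3)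
    (hsmooth : ContDiff ℝ 1 (fun p : ℝ × ℝ => γ p.1 p.2))
    (hclosed : ∀ t ∈ Icc (0:ℝ) T, γ t 0 = γ t 1)
    (heq : ∀ t ∈ Icc (0:ℝ) T, ∀ ξ ∈ Icc (0:ℝ) 1,
      deriv (fun s => γ s ξ) t = velocity φ (γ t) (deriv (γ t)) (γ t ξ)) :
    ∀ t ∈ Icc (0:ℝ) T,
      energy φ (γ t) (deriv (γ t)) = energy φ (γ 0) (deriv (γ 0)) := by
  replace heq : ∀ t ∈ Icc (0:ℝ) T, ∀ ξ ∈ Icc (0:ℝ) 1,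
      deriv (fun s => γ s ξ) t = selfVelocity φ γ t ξ := by
    simpa only [selfVelocity] using heq
  have hderiv : ∀ t ∈ Icc (0:ℝ) T, HasDerivAt (fun s => energy φ (γ s) (tangent φ γ s)) 0 t := by
    intro t ht
    rw [← integral_integral_energyRate hφ2 hsmooth hclosed heq ht]
    exact hasDerivAt_energy_tangent hA.even hφ2 hsmooth t
  have htangent : ∀ t ∈ Icc (0:ℝ) T,
      energy φ (γ t) (deriv (γ t)) = energy φ (γ t) (tangent φ γ t) := by
    intro t ht
    unfold energy
    congr 1
    refine intervalIntegral.integral_congr fun ξ hξ => ?_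
    refine intervalIntegral.integral_congr fun η hη => ?_
    rw [uIcc_of_le zero_le_one] at hξ hη
    simp only [deriv_eq_tangent hφ2 hsmooth heq ht hξ, deriv_eq_tangent hφ2 hsmooth heq ht hη]
  intro t ht
  rw [htangent t ht, htangent 0 ⟨le_rfl, hT.le⟩]
  exact constant_of_has_deriv_right_zero
    (fun s hs => (hderiv s hs).continuousAt.continuousWithinAt)
    (fun s hs => (hderiv s ⟨hs.1, hs.2.le⟩).hasDerivWithinAt) t ht
end
end
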